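/- Let G_n be a sequence of simple d_n-regular graphs on n vertices with d_n → ∞, and let A_n(i,j) = 1{(i,j)∈E_n}/d_n. Let β ≥ 0, J = β·I_q, and h ∈ ℝ^q. Then lim_{n→∞} (1/n)·Φ_n = sup_{θ} [ (β/2)·Σ_{r=1}^q θ(r)² − Σ_{r=1}^q θ(r)·log θ(r) + Σ_{r=1}^q h(r)·θ(r) ], where the supremum is over all probability vectors θ on {1,…,q}. -/

import Mathlib

open Finset Filter Real

noncomputable def pottsH {n q : ℕ} (A : Matrix (Fin n) (Fin n) ℝ)
    (J : Matrix (Fin q) (Fin q) ℝ) (h : Fin q → ℝ) (y : Fin n → Fin q) : ℝ :=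
  (1 / 2) * ∑ i, ∑ j, A i j * J (y i) (y j) + ∑ i, h (y i)

noncomputable def pottsPhi {n q : ℕ} (A : Matrix (Fin n) (Fin n) ℝ)
    (J : Matrix (Fin q) (Fin q) ℝ) (h : Fin q → ℝ) : ℝ :=
  Real.log (∑ y : Fin n → Fin q, Real.exp (pottsH A J h y))

def probVec {q : ℕ} (θ : Fin q → ℝ) : Prop :=
  (∀ r, 0 ≤ θ r) ∧ ∑ r, θ r = 1

open scoped Classical in
/-- The scaled adjacency matrix of a simple graph: entry `(i,j)` is `c` if `i ∼ j`, else `0`. -/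
noncomputable def scaledAdj {n : ℕ} (G : SimpleGraph (Fin n)) (c : ℝ) :
    Matrix (Fin n) (Fin n) ℝ :=
  fun i j => if G.Adj i j then c else 0

open scoped Classical in
/-- Degree of a vertex in a simple graph on `Fin n`. -/
noncomputable def vertexDegree {n : ℕ} (G : SimpleGraph (Fin n)) (v : Fin n) : ℕ :=
  G.degree v

/-- The Curie–Weiss mean-field value: the supremum over probability vectors on `[q]`. -/
noncomputable def curieWeissSup (q : ℕ) (β : ℝ) (h : Fin q → ℝ) : ℝ :=
  sSup {x | ∃ θ : Fin q → ℝ, probVec θ ∧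
    x = (β / 2) * ∑ r, θ r ^ 2 - ∑ r, θ r * Real.log (θ r) + ∑ r, h r * θ r}

section ProductWeights

variable {ι α : Type*} [Fintype ι] [DecidableEq ι] [Fintype α]

theorem sum_prod_eq_prod_sum (g : ι → α → ℝ) :
    ∑ c : ι → α, ∏ i, g i (c i) = ∏ i, ∑ a, g i a := by
  classical
  rw [Finset.prod_univ_sum, Fintype.piFinset_univ]

theorem sum_prod_eq_one {w : α → ℝ} (hw : ∑ a, w a = 1) :
    ∑ c : ι → α, ∏ i, w (c i) = 1 := by
  rw [sum_prod_eq_prod_sum (fun _ => w)]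
  simp [hw]

theorem sum_prod_mul_apply {w : α → ℝ} (hw : ∑ a, w a = 1) (F : α → ℝ) (i : ι) :
    ∑ c : ι → α, (∏ k, w (c k)) * F (c i) = ∑ a, w a * F a := by
  have h := sum_prod_eq_prod_sum (fun (k : ι) a => w a * (if k = i then F a else 1))
  simp only [Finset.prod_mul_distrib, Finset.prod_ite_eq', Finset.mem_univ, if_true] at h
  rw [h, Finset.prod_eq_single i]
  · simp
  · intro k _ hk
    simp [hk, hw]
  · simp

theorem sum_prod_mul_apply_mul_apply {w : α → ℝ} (hw : ∑ a, w a = 1) (F G : α → ℝ) {i j : ι}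
    (hij : i ≠ j) :
    ∑ c : ι → α, (∏ k, w (c k)) * (F (c i) * G (c j)) =
      (∑ a, w a * F a) * ∑ a, w a * G a := by
  have h := sum_prod_eq_prod_sum
    (fun (k : ι) a => w a * ((if k = i then F a else 1) * (if k = j then G a else 1)))
  simp only [Finset.prod_mul_distrib, Finset.prod_ite_eq', Finset.mem_univ, if_true] at h
  rw [h]
  have h2 : ∀ k : ι, ∑ a, w a * ((if k = i then F a else 1) * (if k = j then G a else 1)) =
      (if k = i then ∑ a, w a * F a else 1) * (if k = j then ∑ a, w a * G a else 1) := by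
    intro k
    by_cases hi : k = i
    · simp [hi, hij]
    · by_cases hj : k = j
      · simp [hj, hij.symm]
      · simp [hi, hj, hw]
  simp only [h2, Finset.prod_mul_distrib, Finset.prod_ite_eq', Finset.mem_univ, if_true]

/-- The second moment of a linear combination of independent centred variables. -/
theorem sum_prod_mul_sq_of_centered {w : α → ℝ} (hw : ∑ a, w a = 1) {F : α → ℝ}
    (hF : ∑ a, w a * F a = 0) (x : ι → ℝ) :
    ∑ c : ι → α, (∏ k, w (c k)) * (∑ j, x j * F (c j)) ^ 2 =
      (∑ j, x j ^ 2) * ∑ a, w a * F a ^ 2 := by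
  have h1 : ∀ c : ι → α, (∏ k, w (c k)) * (∑ j, x j * F (c j)) ^ 2 =
      ∑ j, ∑ k, x j * x k * ((∏ k, w (c k)) * (F (c j) * F (c k))) := by
    intro c
    rw [sq, Finset.sum_mul_sum, Finset.mul_sum]
    refine Finset.sum_congr rfl fun j _ => ?_
    rw [Finset.mul_sum]
    exact Finset.sum_congr rfl fun k _ => by ring
  simp only [h1]
  rw [Finset.sum_comm, Finset.sum_mul]
  refine Finset.sum_congr rfl fun j _ => ?_
  rw [Finset.sum_comm, Finset.sum_eq_single j]
  · rw [← Finset.mul_sum, ← sum_prod_mul_apply hw (fun a => F a ^ 2) j, ← sq]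
    simp only [sq]
  · intro k _ hk
    rw [← Finset.mul_sum, sum_prod_mul_apply_mul_apply hw F F hk.symm, hF]
    simp
  · simp

end ProductWeights

theorem mul_log_sub_log_le {x z : ℝ} (hx : 0 ≤ x) (hz : 0 < z) :
    x * (Real.log z - Real.log x) ≤ z - x := by
  rcases hx.eq_or_lt with rfl | hx
  · simpa using hz.le
  · rw [← Real.log_div hz.ne' hx.ne']
    have := mul_le_mul_of_nonneg_left (Real.log_le_sub_one_of_pos (div_pos hz hx)) hx.le
    have h2 : x * (z / x - 1) = z - x := by field_simp
    linarith

/-- Subadditivity of entropy: the entropy of `μ` is at most the sum of the entropies of its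
marginals `θ i`. -/
theorem sum_marginal_mul_log_le {ι α : Type*} [Fintype ι] [DecidableEq ι] [Fintype α]
    [DecidableEq α] (C : Finset (ι → α)) (μ : (ι → α) → ℝ) (hμ : ∀ y ∈ C, 0 < μ y)
    (hsum : ∑ y ∈ C, μ y = 1) (θ : ι → α → ℝ)
    (hθ : ∀ i r, θ i r = ∑ y ∈ C, μ y * (if y i = r then 1 else 0)) :
    ∑ i, ∑ r, θ i r * Real.log (θ i r) ≤ ∑ y ∈ C, μ y * Real.log (μ y) := by
  have hnn : ∀ i r, 0 ≤ θ i r := fun i r => by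
    rw [hθ]
    refine Finset.sum_nonneg fun y hy => mul_nonneg (hμ y hy).le ?_
    split_ifs <;> norm_num
  have hone : ∀ i, ∑ r, θ i r = 1 := fun i => by
    simp only [hθ]
    rw [Finset.sum_comm]
    simpa using hsum
  have hpos : ∀ y ∈ C, ∀ i, 0 < θ i (y i) := fun y hy i => by
    refine (hμ y hy).trans_le ?_
    rw [hθ]
    have := Finset.single_le_sum (f := fun z => μ z * (if z i = y i then (1 : ℝ) else 0))
      (fun z hz => mul_nonneg (hμ z hz).le (by split_ifs <;> norm_num)) hy
    simpa using this
  have h1 : ∑ i, ∑ r, θ i r * Real.log (θ i r) =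
      ∑ y ∈ C, μ y * Real.log (∏ i, θ i (y i)) := by
    have : ∀ y ∈ C, μ y * Real.log (∏ i, θ i (y i)) = ∑ i, μ y * Real.log (θ i (y i)) :=
      fun y hy => by
        rw [Real.log_prod (fun i _ => (hpos y hy i).ne'), Finset.mul_sum]
    rw [Finset.sum_congr rfl this, Finset.sum_comm (s := C)]
    refine Finset.sum_congr rfl fun i _ => ?_
    have h2 : ∀ r, θ i r * Real.log (θ i r) =
        ∑ y ∈ C, μ y * (if y i = r then 1 else 0) * Real.log (θ i r) := fun r => by
      rw [← Finset.sum_mul, ← hθ]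
    simp only [h2]
    rw [Finset.sum_comm]
    exact Finset.sum_congr rfl fun y _ => by simp
  have h2 : ∑ y ∈ C, μ y * (Real.log (∏ i, θ i (y i)) - Real.log (μ y)) ≤
      ∑ y ∈ C, (∏ i, θ i (y i) - μ y) :=
    Finset.sum_le_sum fun y hy =>
      mul_log_sub_log_le (hμ y hy).le (Finset.prod_pos fun i _ => hpos y hy i)
  have h3 : ∑ y ∈ C, ∏ i, θ i (y i) ≤ 1 := by
    calc ∑ y ∈ C, ∏ i, θ i (y i) ≤ ∑ y : ι → α, ∏ i, θ i (y i) :=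
          Finset.sum_le_sum_of_subset_of_nonneg (Finset.subset_univ _)
            fun y _ _ => Finset.prod_nonneg fun i _ => hnn i _
      _ = 1 := by rw [sum_prod_eq_prod_sum]; simp [hone]
  simp only [mul_sub, Finset.sum_sub_distrib] at h2
  linarith

/-- The mean-field functional whose supremum is the Curie–Weiss value. -/
noncomputable def curieWeissVal {q : ℕ} (β : ℝ) (h θ : Fin q → ℝ) : ℝ :=
  (β / 2) * ∑ r, θ r ^ 2 - ∑ r, θ r * Real.log (θ r) + ∑ r, h r * θ r

theorem probVec.le_one {q : ℕ} {θ : Fin q → ℝ} (hθ : probVec θ) (r : Fin q) : θ r ≤ 1 := by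
  rw [← hθ.2]
  exact Finset.single_le_sum (fun i _ => hθ.1 i) (Finset.mem_univ r)

theorem curieWeissVal_le_curieWeissSup {q : ℕ} {β : ℝ} (hβ : 0 ≤ β) (h : Fin q → ℝ)
    {θ : Fin q → ℝ} (hθ : probVec θ) : curieWeissVal β h θ ≤ curieWeissSup q β h := by
  refine le_csSup ⟨(β / 2) * ∑ _r : Fin q, 1 + ∑ _r : Fin q, 1 + ∑ r, |h r|, ?_⟩ ⟨θ, hθ, rfl⟩
  rintro _ ⟨η, hη, rfl⟩
  have h1 : ∑ r, η r ^ 2 ≤ ∑ _r : Fin q, (1 : ℝ) :=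
    Finset.sum_le_sum fun r _ => pow_le_one₀ (hη.1 r) (hη.le_one r)
  have h2 : ∑ r, -(η r * Real.log (η r)) ≤ ∑ _r : Fin q, (1 : ℝ) :=
    Finset.sum_le_sum fun r _ => by
      have := mul_log_sub_log_le (hη.1 r) one_pos
      rw [Real.log_one] at this
      have := hη.1 r
      linarith
  have h3 : ∑ r, h r * η r ≤ ∑ r, |h r| := Finset.sum_le_sum fun r _ => by
    calc h r * η r ≤ |h r| * η r := mul_le_mul_of_nonneg_right (le_abs_self _) (hη.1 r)
      _ ≤ |h r| := mul_le_of_le_one_right (abs_nonneg _) (hη.le_one r)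
  rw [Finset.sum_neg_distrib] at h2
  have := mul_le_mul_of_nonneg_left h1 (div_nonneg hβ zero_le_two)
  linarith

theorem curieWeissSup_le {q : ℕ} (hq : 0 < q) {β : ℝ} {h : Fin q → ℝ} {B : ℝ}
    (hB : ∀ θ, probVec θ → curieWeissVal β h θ ≤ B) : curieWeissSup q β h ≤ B := by
  refine csSup_le ⟨_, fun r => if r = ⟨0, hq⟩ then 1 else 0, ⟨fun r => ?_, by simp⟩, rfl⟩ ?_
  · dsimp only
    split_ifs <;> norm_num
  · rintro _ ⟨θ, hθ, rfl⟩
    exact hB θ hθ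

theorem pottsH_smul_one {n q : ℕ} (A : Matrix (Fin n) (Fin n) ℝ) (β : ℝ) (h : Fin q → ℝ)
    (y : Fin n → Fin q) :
    pottsH A (β • (1 : Matrix (Fin q) (Fin q) ℝ)) h y =
      (β / 2) * ∑ i, ∑ j, A i j * (if y i = y j then 1 else 0) + ∑ i, h (y i) := by
  unfold pottsH
  congr 1
  simp only [Finset.mul_sum, Matrix.smul_apply, Matrix.one_apply, smul_eq_mul]
  exact Finset.sum_congr rfl fun i _ => Finset.sum_congr rfl fun j _ => by ring

section

variable {n q : ℕ} {A : Matrix (Fin n) (Fin n) ℝ}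

/-- The mean-field lower bound, from the Gibbs variational principle at `θ^{⊗n}`. -/
theorem mul_curieWeissVal_le_pottsPhi (hdiag : ∀ i, A i i = 0) (hrow : ∀ i, ∑ j, A i j = 1)
    (β : ℝ) (h : Fin q → ℝ) {θ : Fin q → ℝ} (hθ : probVec θ) :
    n * curieWeissVal β h θ ≤ pottsPhi A (β • (1 : Matrix (Fin q) (Fin q) ℝ)) h := by
  have : Nonempty (Fin q) := by
    by_contra hne
    rw [not_nonempty_iff] at hne
    simpa using hθ.2
  set H := pottsH A (β • (1 : Matrix (Fin q) (Fin q) ℝ)) h with hH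
  unfold pottsPhi
  rw [← hH]
  set Z := ∑ y, Real.exp (H y) with hZ
  have hZpos : 0 < Z := Finset.sum_pos (fun y _ => Real.exp_pos _) Finset.univ_nonempty
  set g : (Fin n → Fin q) → ℝ := fun y => ∏ i, θ (y i) with hg
  have hg0 : ∀ y, 0 ≤ g y := fun y => Finset.prod_nonneg fun i _ => hθ.1 _
  have hg1 : ∑ y, g y = 1 := sum_prod_eq_one hθ.2
  have h1 : ∑ y, g y * (H y - Real.log Z - Real.log (g y)) ≤ 0 := by
    calc _ ≤ ∑ y, (Real.exp (H y) / Z - g y) := Finset.sum_le_sum fun y _ => by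
          have := mul_log_sub_log_le (hg0 y) (div_pos (Real.exp_pos (H y)) hZpos)
          rwa [Real.log_div (Real.exp_pos _).ne' hZpos.ne', Real.log_exp] at this
      _ = 0 := by
          rw [Finset.sum_sub_distrib, hg1, ← Finset.sum_div, ← hZ, div_self hZpos.ne', sub_self]
  have hlin : ∀ F : Fin q → ℝ, ∑ y, g y * ∑ i, F (y i) = n * ∑ r, θ r * F r := by
    intro F
    simp only [Finset.mul_sum]
    rw [Finset.sum_comm]
    have : ∀ i : Fin n, ∑ y, g y * F (y i) = ∑ r, θ r * F r :=
      fun i => sum_prod_mul_apply hθ.2 F i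
    simp [this, Finset.mul_sum]
  have hent : ∑ y, g y * Real.log (g y) = n * ∑ r, θ r * Real.log (θ r) := by
    rw [← hlin fun r => Real.log (θ r)]
    refine Finset.sum_congr rfl fun y _ => ?_
    rcases (hg0 y).eq_or_lt with h0 | h0
    · rw [← h0]; simp
    · rw [hg]
      dsimp only
      rw [Real.log_prod]
      intro i hi
      exact Finset.prod_ne_zero_iff.mp h0.ne' i hi
  have hpair : ∀ i j : Fin n, A i j * ∑ y, g y * (if y i = y j then 1 else 0) =
      A i j * ∑ r, θ r ^ 2 := by
    intro i j
    by_cases hij : i = j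
    · subst hij; simp [hdiag]
    congr 1
    have : ∀ y : Fin n → Fin q, g y * (if y i = y j then (1 : ℝ) else 0) =
        ∑ r, g y * ((if y i = r then 1 else 0) * (if y j = r then 1 else 0)) := by
      intro y
      rw [← Finset.mul_sum]
      congr 1
      simp [eq_comm]
    simp only [this]
    rw [Finset.sum_comm]
    refine Finset.sum_congr rfl fun r _ => ?_
    have := sum_prod_mul_apply_mul_apply hθ.2 (fun a => if a = r then (1 : ℝ) else 0)
      (fun a => if a = r then (1 : ℝ) else 0) hij
    rw [this]
    simp [sq]
  have hEH : ∑ y, g y * H y = n * ((β / 2) * ∑ r, θ r ^ 2 + ∑ r, h r * θ r) := by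
    simp only [hH, pottsH_smul_one, mul_add, Finset.sum_add_distrib]
    rw [hlin h]
    congr 1
    · have : ∀ y, g y * ((β / 2) * ∑ i, ∑ j, A i j * (if y i = y j then (1 : ℝ) else 0)) =
          (β / 2) * ∑ i, ∑ j, A i j * (g y * (if y i = y j then (1 : ℝ) else 0)) := by
        intro y
        simp only [Finset.mul_sum]
        exact Finset.sum_congr rfl fun i _ => Finset.sum_congr rfl fun j _ => by ring
      simp only [this]
      rw [← Finset.mul_sum, Finset.sum_comm]
      have : ∀ i, ∑ y, ∑ j, A i j * (g y * (if y i = y j then (1 : ℝ) else 0)) =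
          ∑ r, θ r ^ 2 := by
        intro i
        rw [Finset.sum_comm]
        simp only [← Finset.mul_sum, hpair]
        rw [← Finset.sum_mul, hrow, one_mul]
      simp only [this]
      simp
      ring
    · congr 1
      exact Finset.sum_congr rfl fun r _ => mul_comm _ _
  simp only [mul_sub, Finset.sum_sub_distrib] at h1
  rw [← Finset.sum_mul, hg1, hent, hEH] at h1
  unfold curieWeissVal
  linarith

theorem quadratic_form_le (hsymm : ∀ i j, A i j = A j i) (hnn : ∀ i j, 0 ≤ A i j)
    (hrow : ∀ i, ∑ j, A i j = 1) (x : Fin n → ℝ) :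
    ∑ i, x i * ∑ j, A i j * x j ≤ ∑ i, x i ^ 2 := by
  have h1 : ∑ i, x i * ∑ j, A i j * x j ≤ ∑ i, ∑ j, (A i j * x i ^ 2 / 2 + A i j * x j ^ 2 / 2) := by
    refine Finset.sum_le_sum fun i _ => ?_
    rw [Finset.mul_sum]
    refine Finset.sum_le_sum fun j _ => ?_
    nlinarith [mul_nonneg (hnn i j) (sq_nonneg (x i - x j))]
  have h2 : ∑ i, ∑ j, A i j * x i ^ 2 / 2 = (∑ i, x i ^ 2) / 2 := by
    rw [Finset.sum_div]
    refine Finset.sum_congr rfl fun i _ => ?_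
    rw [← Finset.sum_div, ← Finset.sum_mul, hrow, one_mul]
  have h3 : ∑ i, ∑ j, A i j * x j ^ 2 / 2 = (∑ i, x i ^ 2) / 2 := by
    rw [← h2, Finset.sum_comm]
    exact Finset.sum_congr rfl fun i _ => Finset.sum_congr rfl fun j _ => by rw [hsymm]
  simp only [Finset.sum_add_distrib] at h1
  linarith

/-- The local fields: `localField A y i r` is the `A`-weight of the neighbours of `i` in
state `r`. -/
noncomputable def localField (A : Matrix (Fin n) (Fin n) ℝ) (y : Fin n → Fin q) (i : Fin n)
    (r : Fin q) : ℝ :=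
  ∑ j, A i j * (if y j = r then 1 else 0)

theorem sum_mul_le_of_sum_sq_le {x v : Fin n → Fin q → ℝ} {K t : ℝ} (ht : 0 < t)
    (hx : ∑ i, ∑ r, x i r ^ 2 ≤ n) (hv : ∑ i, ∑ r, v i r ^ 2 ≤ K) :
    ∑ i, ∑ r, x i r * v i r ≤ (t * n + K / t) / 2 := by
  have h1 : ∑ i, ∑ r, x i r * v i r ≤ ∑ i, ∑ r, (t / 2 * x i r ^ 2 + 1 / (2 * t) * v i r ^ 2) := by
    refine Finset.sum_le_sum fun i _ => Finset.sum_le_sum fun r _ => ?_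
    have h2 : t / 2 * x i r ^ 2 + 1 / (2 * t) * v i r ^ 2 - x i r * v i r =
        (t * x i r - v i r) ^ 2 / (2 * t) := by
      field_simp
      ring
    have h3 : 0 ≤ (t * x i r - v i r) ^ 2 / (2 * t) := by positivity
    linarith
  simp only [Finset.sum_add_distrib, ← Finset.mul_sum] at h1
  have h4 := mul_le_mul_of_nonneg_left hx (half_pos ht).le
  have h5 := mul_le_mul_of_nonneg_left hv (show 0 ≤ 1 / (2 * t) by positivity)
  have h6 : (t * n + K / t) / 2 = t / 2 * n + 1 / (2 * t) * K := by
    field_simp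
  linarith

/-- Upper bound for the partition function restricted to configurations whose local fields are
all close to a common `m`. -/
theorem sum_exp_pottsH_le_of_localField_close (hsymm : ∀ i j, A i j = A j i)
    (hnn : ∀ i j, 0 ≤ A i j) (hrow : ∀ i, ∑ j, A i j = 1) {β : ℝ} (hβ : 0 ≤ β) (h : Fin q → ℝ)
    (C : Finset (Fin n → Fin q)) (m : Fin n → Fin q → ℝ) {K t : ℝ} (ht : 0 < t)
    (hC : ∀ y ∈ C, ∑ i, ∑ r, (m i r - localField A y i r) ^ 2 ≤ K) :
    ∑ y ∈ C, Real.exp (pottsH A (β • (1 : Matrix (Fin q) (Fin q) ℝ)) h y) ≤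
      Real.exp (n * curieWeissSup q β h + β * ((t * n + K / t) / 2)) := by
  rcases C.eq_empty_or_nonempty with rfl | hne
  · simpa using (Real.exp_pos _).le
  set H := pottsH A (β • (1 : Matrix (Fin q) (Fin q) ℝ)) h with hH
  set e := (t * n + K / t) / 2 with he
  set Z := ∑ y ∈ C, Real.exp (H y) with hZ
  have hZpos : 0 < Z := Finset.sum_pos (fun y _ => Real.exp_pos _) hne
  rw [← Real.log_le_iff_le_exp hZpos]
  set μ : (Fin n → Fin q) → ℝ := fun y => Real.exp (H y) / Z with hμ
  have hμpos : ∀ y, 0 < μ y := fun y => div_pos (Real.exp_pos _) hZpos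
  have hμ1 : ∑ y ∈ C, μ y = 1 := by
    simp only [hμ]
    rw [← Finset.sum_div, ← hZ, div_self hZpos.ne']
  let ind : (Fin n → Fin q) → Fin n → Fin q → ℝ := fun y i r => if y i = r then 1 else 0
  let θ : Fin n → Fin q → ℝ := fun i r => ∑ y ∈ C, μ y * ind y i r
  have hind : ∀ y i r, 0 ≤ ind y i r := fun y i r => by
    dsimp only [ind]
    split_ifs <;> norm_num
  have hθ : ∀ i, probVec (θ i) := fun i => by
    refine ⟨fun r => Finset.sum_nonneg fun y _ => mul_nonneg (hμpos y).le (hind y i r), ?_⟩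
    dsimp only [θ]
    rw [Finset.sum_comm]
    simpa [ind] using hμ1
  have havg : ∀ v : Fin n → Fin q → ℝ,
      ∑ i, ∑ r, θ i r * v i r = ∑ y ∈ C, μ y * ∑ i, ∑ r, ind y i r * v i r := by
    intro v
    simp only [θ, Finset.mul_sum, Finset.sum_mul]
    rw [Finset.sum_comm]
    rw [Finset.sum_comm (s := C)]
    rw [Finset.sum_comm]
    refine Finset.sum_congr rfl fun i _ => ?_
    rw [Finset.sum_comm]
    exact Finset.sum_congr rfl fun y _ => Finset.sum_congr rfl fun r _ => by ring
  have hent := sum_marginal_mul_log_le C μ (fun y _ => hμpos y) hμ1 θ (fun i r => rfl)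
  have hlog : ∑ y ∈ C, μ y * Real.log (μ y) = ∑ y ∈ C, μ y * H y - Real.log Z := by
    have : ∀ y, μ y * Real.log (μ y) = μ y * H y - μ y * Real.log Z := fun y => by
      rw [hμ]
      dsimp only
      rw [Real.log_div (Real.exp_pos _).ne' hZpos.ne', Real.log_exp, mul_sub]
    simp only [this]
    rw [Finset.sum_sub_distrib, ← Finset.sum_mul, hμ1, one_mul]
  have hindsq : ∀ y : Fin n → Fin q, ∑ i, ∑ r, ind y i r ^ 2 ≤ n := fun y => by
    simp [ind]
  have hθsq : ∑ i, ∑ r, θ i r ^ 2 ≤ n := by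
    calc ∑ i, ∑ r, θ i r ^ 2 ≤ ∑ i : Fin n, ∑ r, θ i r :=
          Finset.sum_le_sum fun i _ => Finset.sum_le_sum fun r _ =>
            pow_le_of_le_one ((hθ i).1 r) ((hθ i).le_one r) two_ne_zero
      _ = n := by simp [(hθ _).2]
  have hEQ : ∀ y ∈ C, ∑ i, ∑ j, A i j * (if y i = y j then (1 : ℝ) else 0) ≤
      ∑ i, ∑ r, ind y i r * m i r + e := by
    intro y hy
    have h1 : ∑ i, ∑ j, A i j * (if y i = y j then (1 : ℝ) else 0) =
        ∑ i, ∑ r, ind y i r * localField A y i r := by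
      simp [ind, localField, eq_comm]
    have h2 := sum_mul_le_of_sum_sq_le (x := ind y) (v := fun i r => localField A y i r - m i r)
      ht (hindsq y) (K := K) (by
        refine le_trans (le_of_eq ?_) (hC y hy)
        exact Finset.sum_congr rfl fun i _ => Finset.sum_congr rfl fun r _ => by ring)
    simp only [mul_sub, Finset.sum_sub_distrib] at h2
    rw [h1]
    linarith
  have hθA : ∑ i, ∑ r, θ i r * m i r ≤ ∑ i, ∑ r, θ i r ^ 2 + e := by
    have h1 : ∀ y ∈ C, ∑ i, ∑ r, θ i r * m i r ≤
        ∑ i, ∑ r, θ i r * localField A y i r + e := by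
      intro y hy
      have h2 := sum_mul_le_of_sum_sq_le (x := θ) (v := fun i r => m i r - localField A y i r)
        ht hθsq (hC y hy)
      simp only [mul_sub, Finset.sum_sub_distrib] at h2
      linarith
    have h2 : ∑ i, ∑ r, θ i r * m i r ≤
        ∑ y ∈ C, μ y * (∑ i, ∑ r, θ i r * localField A y i r + e) := by
      calc _ = ∑ y ∈ C, μ y * ∑ i, ∑ r, θ i r * m i r := by
            rw [← Finset.sum_mul, hμ1, one_mul]
        _ ≤ _ := Finset.sum_le_sum fun y hy =>
            mul_le_mul_of_nonneg_left (h1 y hy) (hμpos y).le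
    have h3 : ∑ y ∈ C, μ y * (∑ i, ∑ r, θ i r * localField A y i r + e) =
        ∑ r, ∑ i, θ i r * ∑ j, A i j * θ j r + e := by
      simp only [mul_add, Finset.sum_add_distrib]
      rw [← Finset.sum_mul, hμ1, one_mul]
      congr 1
      have h4 : ∀ i r, ∑ j, A i j * θ j r = ∑ y ∈ C, μ y * localField A y i r := by
        intro i r
        simp only [θ, localField, Finset.mul_sum]
        rw [Finset.sum_comm]
        exact Finset.sum_congr rfl fun y _ => Finset.sum_congr rfl fun j _ => by
          dsimp only [ind]
          ring
      simp only [h4]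
      rw [Finset.sum_comm (s := (Finset.univ : Finset (Fin q)))]
      simp only [Finset.mul_sum]
      rw [Finset.sum_comm]
      refine Finset.sum_congr rfl fun i _ => ?_
      rw [Finset.sum_comm]
      exact Finset.sum_congr rfl fun r _ => Finset.sum_congr rfl fun y _ => by ring
    have h5 : ∑ r, ∑ i, θ i r * ∑ j, A i j * θ j r ≤ ∑ r, ∑ i, θ i r ^ 2 :=
      Finset.sum_le_sum fun r _ => quadratic_form_le hsymm hnn hrow fun i => θ i r
    rw [Finset.sum_comm (f := fun r i => θ i r ^ 2)] at h5
    linarith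
  have hh : ∑ y ∈ C, μ y * ∑ i, h (y i) = ∑ i, ∑ r, h r * θ i r := by
    have h1 := havg fun _ r => h r
    have h2 : ∀ y : Fin n → Fin q, ∑ i, h (y i) = ∑ i, ∑ r, ind y i r * h r := fun y => by
      simp [ind]
    simp only [h2, ← h1]
    exact Finset.sum_congr rfl fun i _ => Finset.sum_congr rfl fun r _ => mul_comm _ _
  have hEH : ∑ y ∈ C, μ y * H y ≤
      (β / 2) * (∑ i, ∑ r, θ i r ^ 2 + 2 * e) + ∑ i, ∑ r, h r * θ i r := by
    calc ∑ y ∈ C, μ y * H y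
        ≤ ∑ y ∈ C, ((β / 2) * (μ y * ∑ i, ∑ r, ind y i r * m i r + μ y * e) +
            μ y * ∑ i, h (y i)) := Finset.sum_le_sum fun y hy => by
          rw [hH, pottsH_smul_one]
          have := mul_le_mul_of_nonneg_left (hEQ y hy)
            (mul_nonneg (div_nonneg hβ zero_le_two) (hμpos y).le)
          linarith
      _ = (β / 2) * (∑ i, ∑ r, θ i r * m i r + e) + ∑ i, ∑ r, h r * θ i r := by
          rw [Finset.sum_add_distrib, hh, ← Finset.mul_sum, Finset.sum_add_distrib, ← havg,
            ← Finset.sum_mul, hμ1, one_mul]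
      _ ≤ _ := by
          have := mul_le_mul_of_nonneg_left hθA (div_nonneg hβ zero_le_two)
          linarith
  have hval : ∑ i, curieWeissVal β h (θ i) ≤ n * curieWeissSup q β h := by
    calc _ ≤ ∑ _i : Fin n, curieWeissSup q β h :=
          Finset.sum_le_sum fun i _ => curieWeissVal_le_curieWeissSup hβ h (hθ i)
      _ = _ := by simp
  simp only [curieWeissVal, Finset.sum_add_distrib, Finset.sum_sub_distrib,
    ← Finset.mul_sum] at hval
  linarith

/-- Upper bound by random sampling: `p` is the sampling probability, `t` a free parameter. -/
theorem pottsPhi_le (hn : 0 < n) (hq : 0 < q) (hsymm : ∀ i j, A i j = A j i)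
    (hnn : ∀ i j, 0 ≤ A i j) (hrow : ∀ i, ∑ j, A i j = 1) {δ : ℝ} (hδ : 0 < δ)
    (hsq : ∀ i, ∑ j, A i j ^ 2 ≤ δ) {β : ℝ} (hβ : 0 ≤ β) (h : Fin q → ℝ) {p t : ℝ}
    (hp : 0 < p) (hp1 : p ≤ 1) (ht : 0 < t) :
    pottsPhi A (β • (1 : Matrix (Fin q) (Fin q) ℝ)) h ≤
      Real.log 2 + n * (q * p) + n * curieWeissSup q β h +
        β * ((t * n + (2 * n * δ / p) / t) / 2) := by
  have : Nonempty (Fin q) := ⟨⟨0, hq⟩⟩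
  set H := pottsH A (β • (1 : Matrix (Fin q) (Fin q) ℝ)) h with hH
  set K := 2 * n * δ / p with hK
  have hnR : (0 : ℝ) < n := Nat.cast_pos.mpr hn
  have hKpos : 0 < K := by positivity
  set B := Real.exp (n * curieWeissSup q β h + β * ((t * n + K / t) / 2)) with hB
  let w : Bool → ℝ := fun b => if b then p else 1 - p
  let F : Bool → ℝ := fun b => (if b then 1 / p else 0) - 1
  have hw0 : ∀ b, 0 ≤ w b := by
    intro b
    cases b <;> simp [w, hp.le, hp1]
  have hw : ∑ b, w b = 1 := by simp [w]
  have hF : ∑ b, w b * F b = 0 := by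
    simp [w, F]
    field_simp
    ring
  have hF2 : ∑ b, w b * F b ^ 2 ≤ 1 / p := by
    have : ∑ b, w b * F b ^ 2 = 1 / p - 1 := by
      simp [w, F]
      field_simp
      ring
    linarith
  let W : (Fin n → Bool) → ℝ := fun s => ∏ i, w (s i)
  have hW0 : ∀ s, 0 ≤ W s := fun s => Finset.prod_nonneg fun i _ => hw0 _
  have hW1 : ∑ s, W s = 1 := sum_prod_eq_one hw
  let m : (Fin n → Bool) → (Fin n → Fin q) → Fin n → Fin q → ℝ := fun s y i r =>
    ∑ j, A i j * (if y j = r then 1 else 0) * (if s j then 1 / p else 0)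
  let V : (Fin n → Bool) → (Fin n → Fin q) → ℝ := fun s y =>
    ∑ i, ∑ r, (m s y i r - localField A y i r) ^ 2
  have hV0 : ∀ s y, 0 ≤ V s y := fun s y =>
    Finset.sum_nonneg fun i _ => Finset.sum_nonneg fun r _ => sq_nonneg _
  have hEV : ∀ y, ∑ s, W s * V s y ≤ K / 2 := by
    intro y
    have h1 : ∀ s i r, m s y i r - localField A y i r =
        ∑ j, A i j * (if y j = r then 1 else 0) * F (s j) := by
      intro s i r
      simp only [m, localField, F, ← Finset.sum_sub_distrib]
      exact Finset.sum_congr rfl fun j _ => by ring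
    have h2 : ∑ s, W s * V s y = ∑ i, ∑ r, ∑ s, W s * (m s y i r - localField A y i r) ^ 2 := by
      simp only [V, Finset.mul_sum]
      rw [Finset.sum_comm]
      exact Finset.sum_congr rfl fun i _ => Finset.sum_comm
    have h3 : ∀ i r, ∑ s, W s * (m s y i r - localField A y i r) ^ 2 =
        (∑ j, (A i j * (if y j = r then 1 else 0)) ^ 2) * ∑ b, w b * F b ^ 2 := by
      intro i r
      simp only [h1]
      exact sum_prod_mul_sq_of_centered hw hF _
    have h4 : ∀ i, ∑ r, ∑ j, (A i j * (if y j = r then (1 : ℝ) else 0)) ^ 2 = ∑ j, A i j ^ 2 := by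
      intro i
      rw [Finset.sum_comm]
      simp
    rw [h2]
    simp only [h3, ← Finset.sum_mul, h4]
    calc (∑ i, ∑ j, A i j ^ 2) * ∑ b, w b * F b ^ 2 ≤ (∑ _i : Fin n, δ) * (1 / p) :=
          mul_le_mul (Finset.sum_le_sum fun i _ => hsq i) hF2
            (Finset.sum_nonneg fun b _ => mul_nonneg (hw0 b) (sq_nonneg _))
            (Finset.sum_nonneg fun _ _ => hδ.le)
      _ = K / 2 := by
          rw [hK]
          simp
          ring
  have hgood : ∀ y, 1 / 2 ≤ ∑ s, W s * (if V s y ≤ K then 1 else 0) := by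
    intro y
    have h1 : ∑ s, (W s - W s * V s y / K) ≤ ∑ s, W s * (if V s y ≤ K then 1 else 0) := by
      refine Finset.sum_le_sum fun s _ => ?_
      have h2 : W s - W s * V s y / K = W s * (1 - V s y / K) := by ring
      rw [h2]
      refine mul_le_mul_of_nonneg_left ?_ (hW0 s)
      split_ifs with hle
      · have := div_nonneg (hV0 s y) hKpos.le
        linarith
      · have := (one_le_div hKpos).mpr (not_le.mp hle).le
        linarith
    rw [Finset.sum_sub_distrib, hW1, ← Finset.sum_div] at h1
    have h3 : (∑ s, W s * V s y) / K ≤ 1 / 2 := by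
      rw [div_le_iff₀ hKpos]
      linarith [hEV y]
    linarith
  have hcell : ∀ s : Fin n → Bool,
      ∑ y, (if V s y ≤ K then 1 else 0) * Real.exp (H y) ≤
        (∏ i, (if s i then (q : ℝ) else 1)) * B := by
    intro s
    let ρ : (Fin n → Fin q) → Fin n → Fin q := fun y i => if s i then y i else ⟨0, hq⟩
    let T : Finset (Fin n → Fin q) :=
      Fintype.piFinset fun i => if s i then Finset.univ else {⟨0, hq⟩}
    have hmaps : ∀ y ∈ Finset.univ.filter (fun y => V s y ≤ K), ρ y ∈ T := by
      intro y _
      simp only [T, ρ, Fintype.mem_piFinset]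
      intro i
      split_ifs <;> simp
    have hcard : (T.card : ℝ) = ∏ i, (if s i then (q : ℝ) else 1) := by
      simp only [T, Fintype.card_piFinset, Nat.cast_prod]
      refine Finset.prod_congr rfl fun i _ => ?_
      split_ifs <;> simp
    have hm : ∀ y, m s (ρ y) = m s y := by
      intro y
      ext i r
      refine Finset.sum_congr rfl fun j _ => ?_
      by_cases hj : s j <;> simp [ρ, hj]
    have h1 : ∑ y, (if V s y ≤ K then 1 else 0) * Real.exp (H y) =
        ∑ y ∈ Finset.univ.filter (fun y => V s y ≤ K), Real.exp (H y) := by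
      rw [Finset.sum_filter]
      exact Finset.sum_congr rfl fun y _ => by split_ifs <;> simp
    rw [h1, ← Finset.sum_fiberwise_of_maps_to hmaps, ← hcard, ← nsmul_eq_mul]
    refine Finset.sum_le_card_nsmul _ _ _ fun τ _ => ?_
    refine sum_exp_pottsH_le_of_localField_close hsymm hnn hrow hβ h _ (m s τ) ht ?_
    intro y hy
    simp only [Finset.mem_filter, Finset.mem_univ, true_and] at hy
    rw [← hy.2, hm]
    exact hy.1
  have hcount : ∑ s, W s * ∏ i, (if s i then (q : ℝ) else 1) ≤ Real.exp (n * (q * p)) := by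
    have h1 : ∑ s, W s * ∏ i, (if s i then (q : ℝ) else 1) =
        ∑ s : Fin n → Bool, ∏ i, (w (s i) * (if s i then (q : ℝ) else 1)) :=
      Finset.sum_congr rfl fun s _ => Finset.prod_mul_distrib.symm
    rw [h1, sum_prod_eq_prod_sum (fun _ b => w b * (if b then (q : ℝ) else 1)), Real.exp_nat_mul]
    simp only [Finset.prod_const, Finset.card_univ, Fintype.card_fin]
    refine pow_le_pow_left₀ ?_ ?_ n
    · refine Finset.sum_nonneg fun b _ => mul_nonneg (hw0 b) ?_
      split_ifs <;> simp
    · have := Real.add_one_le_exp (q * p)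
      simp [w]
      nlinarith
  have hZ : ∑ y, Real.exp (H y) ≤ 2 * (Real.exp (n * (q * p)) * B) := by
    calc ∑ y, Real.exp (H y)
        ≤ ∑ y, 2 * ((∑ s, W s * (if V s y ≤ K then 1 else 0)) * Real.exp (H y)) :=
          Finset.sum_le_sum fun y _ => by nlinarith [hgood y, Real.exp_pos (H y)]
      _ = 2 * ∑ s, W s * ∑ y, (if V s y ≤ K then 1 else 0) * Real.exp (H y) := by
          rw [← Finset.mul_sum]
          congr 1
          simp only [Finset.sum_mul, Finset.mul_sum]
          rw [Finset.sum_comm]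
          exact Finset.sum_congr rfl fun s _ => Finset.sum_congr rfl fun y _ => by ring
      _ ≤ 2 * ∑ s, W s * ((∏ i, (if s i then (q : ℝ) else 1)) * B) := by
          refine mul_le_mul_of_nonneg_left ?_ zero_le_two
          exact Finset.sum_le_sum fun s _ => mul_le_mul_of_nonneg_left (hcell s) (hW0 s)
      _ = 2 * ((∑ s, W s * ∏ i, (if s i then (q : ℝ) else 1)) * B) := by
          rw [Finset.sum_mul]
          congr 1
          exact Finset.sum_congr rfl fun s _ => by ring
      _ ≤ _ := by
          refine mul_le_mul_of_nonneg_left ?_ zero_le_two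
          exact mul_le_mul_of_nonneg_right hcount (Real.exp_pos _).le
  have hZpos : 0 < ∑ y, Real.exp (H y) :=
    Finset.sum_pos (fun y _ => Real.exp_pos _) Finset.univ_nonempty
  have h1 := Real.log_le_log hZpos hZ
  rw [Real.log_mul two_ne_zero (by positivity), hB, ← Real.exp_add, Real.log_exp] at h1
  unfold pottsPhi
  rw [← hH]
  linarith

end

theorem sum_scaledAdj {n : ℕ} (G : SimpleGraph (Fin n)) (c : ℝ) (i : Fin n) :
    ∑ j, scaledAdj G c i j = vertexDegree G i * c := by
  classical
  simp only [scaledAdj, vertexDegree]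
  rw [← Finset.sum_filter, Finset.sum_const, nsmul_eq_mul, ← SimpleGraph.card_neighborFinset_eq_degree]
  congr 3
  ext j
  simp

theorem sum_scaledAdj_sq {n : ℕ} (G : SimpleGraph (Fin n)) (c : ℝ) (i : Fin n) :
    ∑ j, scaledAdj G c i j ^ 2 = vertexDegree G i * c ^ 2 := by
  rw [← sum_scaledAdj]
  refine Finset.sum_congr rfl fun j _ => ?_
  simp only [scaledAdj]
  split_ifs <;> simp

theorem regular_graph_limit (q : ℕ) (hq : 2 ≤ q) (β : ℝ) (hβ : 0 ≤ β) (h : Fin q → ℝ)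
    (G : (n : ℕ) → SimpleGraph (Fin n)) (d : ℕ → ℕ)
    (hreg : ∀ n : ℕ, ∀ v : Fin n, vertexDegree (G n) v = d n)
    (hd : Tendsto d atTop atTop) :
    Tendsto
      (fun n : ℕ =>
        pottsPhi (scaledAdj (G n) (1 / (d n : ℝ)))
          (β • (1 : Matrix (Fin q) (Fin q) ℝ)) h / n)
      atTop (nhds (curieWeissSup q β h)) := by
  let a : ℕ → ℝ := fun n => (d n : ℝ) ^ (-(1 / 4) : ℝ)
  have ha : Tendsto a atTop (nhds 0) :=
    (tendsto_rpow_neg_atTop (by norm_num : (0 : ℝ) < 1 / 4)).comp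
      (tendsto_natCast_atTop_atTop.comp hd)
  have hupper : Tendsto (fun n : ℕ => Real.log 2 / n + q * a n ^ 2 + curieWeissSup q β h +
      β * (3 / 2 * a n)) atTop (nhds (curieWeissSup q β h)) := by
    have h1 : Tendsto (fun n : ℕ => Real.log 2 / n) atTop (nhds 0) :=
      tendsto_const_div_atTop_nhds_zero_nat _
    have h2 := ((h1.add ((ha.pow 2).const_mul (q : ℝ))).add_const (curieWeissSup q β h)).add
      ((ha.const_mul (3 / 2 : ℝ)).const_mul β)
    simpa using h2
  refine tendsto_of_tendsto_of_tendsto_of_le_of_le' tendsto_const_nhds hupper ?_ ?_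
  all_goals
    filter_upwards [hd.eventually_ge_atTop 1, eventually_gt_atTop 0] with n hdn hn
    have hnR : (0 : ℝ) < n := Nat.cast_pos.mpr hn
    have hdR : (0 : ℝ) < d n := Nat.cast_pos.mpr hdn
    have hrow : ∀ i, ∑ j, scaledAdj (G n) (1 / (d n : ℝ)) i j = 1 := fun i => by
      rw [sum_scaledAdj, hreg]
      field_simp
  · refine curieWeissSup_le (by omega) fun θ hθ => ?_
    rw [le_div_iff₀ hnR, mul_comm]
    exact mul_curieWeissVal_le_pottsPhi (fun i => by simp [scaledAdj]) hrow β h hθ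
  · have hapos : 0 < a n := Real.rpow_pos_of_pos hdR _
    have ha1 : a n ≤ 1 :=
      Real.rpow_le_one_of_one_le_of_nonpos (by exact_mod_cast hdn) (by norm_num)
    have ha4 : a n ^ 4 = 1 / d n := by
      rw [← Real.rpow_natCast, ← Real.rpow_mul hdR.le]
      norm_num
      exact Real.rpow_neg_one _
    have hle := pottsPhi_le (A := scaledAdj (G n) (1 / (d n : ℝ))) (δ := 1 / d n) (q := q)
      (p := a n ^ 2) (t := a n) hn (by omega)
      (fun i j => by by_cases hij : (G n).Adj i j <;> simp [scaledAdj, hij, (G n).adj_comm j i])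
      (fun i j => by
        simp only [scaledAdj]
        split_ifs <;> positivity)
      hrow (by positivity)
      (fun i => by
        rw [sum_scaledAdj_sq, hreg]
        apply le_of_eq
        field_simp)
      hβ h (by positivity) (pow_le_one₀ hapos.le ha1) hapos
    rw [div_le_iff₀ hnR]
    refine hle.trans (le_of_eq ?_)
    rw [← ha4]
    field_simp
    ring
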